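/- Let γ ≥ 1 and let y : (Fin m →₀ ℕ) → ℝ be a moment sequence such that y_0 = 1, the moment matrix M_γ(y) is positive semidefinite, and rank M_γ(y) = 1. Then there exists a unique point x ∈ ℝ^m such that y_α = x^α for every exponent vector α with |α| ≤ 2γ; moreover x is given explicitly by the first-order moments, x_i = y_{e_i} where e_i is the i-th unit exponent vector. -/

import Mathlib

open MvPolynomial

noncomputable section

/-- Total degree of an exponent vector `α ∈ (Fin m →₀ ℕ)`. -/
def degSum {m : ℕ} (α : Fin m →₀ ℕ) : ℕ := ∑ i, α i

/-- Index set of the order-`γ` moment matrix: exponent vectors of total degree at most `γ`. -/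
def MomIdx (m γ : ℕ) : Type := {α : Fin m →₀ ℕ // degSum α ≤ γ}

instance momIdxFinite (m γ : ℕ) : Finite (MomIdx m γ) := by
  have h : ∀ (a : MomIdx m γ) (i : Fin m), a.1 i < γ + 1 := fun a i =>
    Nat.lt_succ_of_le (le_trans
      (Finset.single_le_sum (fun j _ => Nat.zero_le (a.1 j)) (Finset.mem_univ i)) a.2)
  exact Finite.of_injective
    (fun a : MomIdx m γ => (fun i => (⟨a.1 i, h a i⟩ : Fin (γ + 1))))
    (fun a b hab => Subtype.ext (Finsupp.ext fun i =>
      congrArg Fin.val (congrFun hab i)))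

instance momIdxFintype (m γ : ℕ) : Fintype (MomIdx m γ) := Fintype.ofFinite _

/-- The monomial `x^α = ∏ i, x i ^ α i`. -/
def monoEval {m : ℕ} (x : Fin m → ℝ) (α : Fin m →₀ ℕ) : ℝ := ∏ i, x i ^ α i

/-- The order-`γ` moment matrix of a moment sequence `y`. -/
def momMat {m : ℕ} (γ : ℕ) (y : (Fin m →₀ ℕ) → ℝ) :
    Matrix (MomIdx m γ) (MomIdx m γ) ℝ :=
  Matrix.of fun a b => y (a.1 + b.1)

/-- The localizing matrix of a polynomial `g` with respect to a moment sequence `y`,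
indexed by exponent vectors of total degree at most `η`. -/
def locMat {m : ℕ} (η : ℕ) (g : MvPolynomial (Fin m) ℝ) (y : (Fin m →₀ ℕ) → ℝ) :
    Matrix (MomIdx m η) (MomIdx m η) ℝ :=
  Matrix.of fun a b => ∑ δ ∈ g.support, g.coeff δ * y (a.1 + b.1 + δ)

/-- The linear functional `L_y` replacing each monomial of a polynomial by its moment. -/
def Lf {m : ℕ} (y : (Fin m →₀ ℕ) → ℝ) (f : MvPolynomial (Fin m) ℝ) : ℝ :=
  ∑ α ∈ f.support, f.coeff α * y α

lemma degSum_add {m : ℕ} (α β : Fin m →₀ ℕ) : degSum (α + β) = degSum α + degSum β := by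
  simp [degSum, Finset.sum_add_distrib]

@[simp]
lemma degSum_zero {m : ℕ} : degSum (0 : Fin m →₀ ℕ) = 0 := by
  simp [degSum]

lemma degSum_single {m : ℕ} (i : Fin m) (n : ℕ) : degSum (Finsupp.single i n) = n := by
  simp [degSum, Finsupp.single_apply]

lemma monoEval_add {m : ℕ} (x : Fin m → ℝ) (α β : Fin m →₀ ℕ) :
    monoEval x (α + β) = monoEval x α * monoEval x β := by
  simp [monoEval, pow_add, Finset.prod_mul_distrib]

lemma monoEval_zero {m : ℕ} (x : Fin m → ℝ) : monoEval x 0 = 1 := by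
  simp [monoEval]

lemma monoEval_single_one {m : ℕ} (x : Fin m → ℝ) (i : Fin m) :
    monoEval x (Finsupp.single i 1) = x i := by
  rw [monoEval, Finset.prod_eq_single i]
  · simp
  · intro j _ hj
    simp [Finsupp.single_eq_of_ne hj]
  · simp

lemma eq_zero_or_exists_eq_single_add {m : ℕ} (α : Fin m →₀ ℕ) :
    α = 0 ∨ ∃ i β, α = Finsupp.single i 1 + β := by
  by_cases h : α = 0
  · exact Or.inl h
  · obtain ⟨i, hi⟩ := Finsupp.ne_iff.mp h
    refine Or.inr ⟨i, α - Finsupp.single i 1, (add_tsub_cancel_of_le ?_).symm⟩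
    exact Finsupp.single_le_iff.mpr (Nat.one_le_iff_ne_zero.mpr hi)

/-- An exponent vector of degree at most `p + q` splits into parts of degrees at most `p`, `q`. -/
lemma exists_add_of_degSum_le {m : ℕ} (p q : ℕ) (α : Fin m →₀ ℕ) (h : degSum α ≤ p + q) :
    ∃ a b, α = a + b ∧ degSum a ≤ p ∧ degSum b ≤ q := by
  induction p generalizing α with
  | zero => exact ⟨0, α, by simp, by simp, by simpa using h⟩
  | succ p ih =>
    rcases eq_zero_or_exists_eq_single_add α with rfl | ⟨i, β, rfl⟩
    · exact ⟨0, 0, by simp, by simp, by simp⟩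
    · rw [degSum_add, degSum_single] at h
      obtain ⟨a, b, rfl, ha, hb⟩ := ih β (by lia)
      refine ⟨Finsupp.single i 1 + a, b, (add_assoc _ _ _).symm, ?_, hb⟩
      rw [degSum_add, degSum_single]
      lia

/-- In a matrix of rank one with `M i j ≠ 0`, every entry is determined by row `i` and
column `j`. -/
lemma Matrix.mul_apply_eq_of_rank_eq_one {n K : Type*} [Fintype n] [Field K]
    {M : Matrix n n K} (hM : M.rank = 1) {i j : n} (hij : M i j ≠ 0) (a b : n) :
    M i j * M a b = M i b * M a j := by
  classical
  have hcol (b : n) : M.col b ∈ LinearMap.range M.mulVecLin :=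
    ⟨Pi.single b 1, by simp⟩
  have hne : (⟨M.col j, hcol j⟩ : LinearMap.range M.mulVecLin) ≠ 0 := fun h =>
    hij (congrFun (congrArg Subtype.val h) i)
  obtain ⟨c, hc⟩ := (finrank_eq_one_iff_of_nonzero' _ hne).mp hM ⟨M.col b, hcol b⟩
  have hentry (a : n) : c * M a j = M a b := congrFun (congrArg Subtype.val hc) a
  rw [← hentry a, ← hentry i]
  ring

lemma momMat_apply {m γ : ℕ} (y : (Fin m →₀ ℕ) → ℝ) (a b : MomIdx m γ) :
    momMat γ y a b = y (a.1 + b.1) := rfl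

lemma moment_add_of_rank_eq_one {m γ : ℕ} {y : (Fin m →₀ ℕ) → ℝ} (hy0 : y 0 = 1)
    (hrank : (momMat γ y).rank = 1) {α β : Fin m →₀ ℕ} (hα : degSum α ≤ γ)
    (hβ : degSum β ≤ γ) : y (α + β) = y α * y β := by
  obtain ⟨o, ho⟩ : ∃ o : MomIdx m γ, o.1 = 0 := ⟨⟨0, by simp⟩, rfl⟩
  obtain ⟨a, rfl⟩ : ∃ a : MomIdx m γ, a.1 = α := ⟨⟨α, hα⟩, rfl⟩
  obtain ⟨b, rfl⟩ : ∃ b : MomIdx m γ, b.1 = β := ⟨⟨β, hβ⟩, rfl⟩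
  have h := Matrix.mul_apply_eq_of_rank_eq_one hrank (i := o) (j := o)
    (by simp [momMat_apply, ho, hy0]) a b
  simpa [momMat_apply, ho, hy0, mul_comm] using h

/-- Moments multiplicative up to degree `γ` are monomials in the first-order moments. -/
lemma moment_eq_monoEval {m γ : ℕ} (hγ : 1 ≤ γ) {y : (Fin m →₀ ℕ) → ℝ} (hy0 : y 0 = 1)
    (hmul : ∀ α β, degSum α ≤ γ → degSum β ≤ γ → y (α + β) = y α * y β)
    (α : Fin m →₀ ℕ) (hα : degSum α ≤ 2 * γ) :
    y α = monoEval (fun i => y (Finsupp.single i 1)) α := by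
  have low (n : ℕ) (hn : n ≤ γ) : ∀ α : Fin m →₀ ℕ, degSum α ≤ n →
      y α = monoEval (fun i => y (Finsupp.single i 1)) α := by
    induction n with
    | zero =>
      intro α hα
      rcases eq_zero_or_exists_eq_single_add α with rfl | ⟨i, β, rfl⟩
      · rw [hy0, monoEval_zero]
      · rw [degSum_add, degSum_single] at hα
        lia
    | succ n ih =>
      intro α hα
      rcases eq_zero_or_exists_eq_single_add α with rfl | ⟨i, β, rfl⟩
      · rw [hy0, monoEval_zero]
      · rw [degSum_add, degSum_single] at hα
        rw [hmul _ _ (by rwa [degSum_single]) (by lia), monoEval_add, monoEval_single_one,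
          ih (by lia) β (by lia)]
  obtain ⟨a, b, rfl, ha, hb⟩ := exists_add_of_degSum_le γ γ α (by lia)
  rw [hmul a b ha hb, monoEval_add, low γ le_rfl a ha, low γ le_rfl b hb]

/-- if `y 0 = 1` and the order-`γ` moment matrix (with `γ ≥ 1`) is positive
semidefinite of rank one, then there is a unique point `x` with `y_α = x^α` for all
`|α| ≤ 2γ`, and this point is given by the first-order moments `x i = y (e i)`. -/
theorem rank_one_moment_matrix_solution_extraction
    (m γ : ℕ) (hγ : 1 ≤ γ) (y : (Fin m →₀ ℕ) → ℝ)
    (hy0 : y 0 = 1)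
    (hpsd : (momMat γ y : Matrix (MomIdx m γ) (MomIdx m γ) ℝ).PosSemidef)
    (hrank : (momMat γ y : Matrix (MomIdx m γ) (MomIdx m γ) ℝ).rank = 1) :
    (∃! x : Fin m → ℝ, ∀ α : Fin m →₀ ℕ, degSum α ≤ 2 * γ → y α = monoEval x α) ∧
    (∀ α : Fin m →₀ ℕ, degSum α ≤ 2 * γ →
      y α = monoEval (fun i => y (Finsupp.single i 1)) α) := by
  have hmono := moment_eq_monoEval hγ hy0 fun _ _ => moment_add_of_rank_eq_one hy0 hrank
  refine ⟨⟨_, hmono, fun x hx => funext fun i => ?_⟩, hmono⟩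
  rw [hx _ (by rw [degSum_single]; lia), monoEval_single_one]
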